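/- The Gaussian mechanism with sensitivity Δ and noise standard deviation σ is (ε, δ)-differentially private whenever σ ≥ Δ·√(2 log(1.25/δ))/ε, for ε ∈ (0,1) and δ ∈ (0,1). -/

import Mathlib

open MeasureTheory ProbabilityTheory Real

/-- A finite product of nondegenerate Gaussian measures has the product density. -/
lemma pi_gaussianReal_eq_withDensity {ι : Type*} [Fintype ι] (a : ι → ℝ) {v : NNReal}
    (hv : v ≠ 0) :
    Measure.pi (fun i ↦ gaussianReal (a i) v) =
      (volume : Measure (ι → ℝ)).withDensity
        (fun x ↦ ENNReal.ofReal (∏ i, gaussianPDFReal (a i) v (x i))) := by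
  refine Measure.pi_eq fun s hs ↦ ?_
  rw [withDensity_apply _ (MeasurableSet.univ_pi hs), volume_pi,
    Measure.restrict_pi_pi (fun _ : ι ↦ (volume : Measure ℝ)),
    ← ofReal_integral_eq_lintegral_ofReal, integral_fintype_prod_eq_prod,
    ENNReal.ofReal_prod_of_nonneg]
  · exact Finset.prod_congr rfl fun i _ ↦ (gaussianReal_apply_eq_integral _ hv _).symm
  · exact fun i _ ↦ integral_nonneg fun x ↦ gaussianPDFReal_nonneg _ _ _
  · exact Integrable.fintype_prod fun i ↦ (integrable_gaussianPDFReal _ _).restrict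
  · exact ae_of_all _ fun x ↦ Finset.prod_nonneg fun i _ ↦ gaussianPDFReal_nonneg _ _ _

/-- A linear combination of independent centered Gaussians of equal variance is Gaussian. -/
lemma map_sum_mul_pi_gaussianReal {ι : Type*} [Fintype ι] (w : ι → ℝ) (v : NNReal) :
    (Measure.pi fun _ : ι ↦ gaussianReal 0 v).map (fun z ↦ ∑ i, w i * z i) =
      gaussianReal 0 ((∑ i, ‖w i‖₊ ^ 2) * v) := by
  have : IsProbabilityMeasure
      ((Measure.pi fun _ : ι ↦ gaussianReal 0 v).map (fun z ↦ ∑ i, w i * z i)) :=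
    Measure.isProbabilityMeasure_map (Measurable.aemeasurable (by fun_prop))
  refine Measure.ext_of_charFun (funext fun t ↦ ?_)
  rw [charFun_apply_real, integral_map (Measurable.aemeasurable (by fun_prop))
    (Measurable.aestronglyMeasurable (by fun_prop)), charFun_gaussianReal]
  have h : ∀ z : ι → ℝ, Complex.exp (t * ((∑ i, w i * z i : ℝ) : ℂ) * Complex.I) =
      ∏ i, Complex.exp ((t * w i : ℝ) * (z i : ℂ) * Complex.I) := fun z ↦ by
    rw [← Complex.exp_sum]
    push_cast
    rw [Finset.mul_sum, Finset.sum_mul]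
    congr 1
    exact Finset.sum_congr rfl fun i _ ↦ by ring
  simp_rw [h]
  rw [integral_fintype_prod_eq_prod
    (f := fun i (x : ℝ) ↦ Complex.exp ((t * w i : ℝ) * (x : ℂ) * Complex.I))]
  have hchar : ∀ i, ∫ x, Complex.exp ((t * w i : ℝ) * (x : ℂ) * Complex.I) ∂gaussianReal 0 v =
      _ := fun i ↦ (charFun_apply_real (μ := gaussianReal 0 v) (t * w i)).symm.trans
    (charFun_gaussianReal _)
  rw [Finset.prod_congr rfl fun i _ ↦ hchar i, ← Complex.exp_sum]
  congr 1
  have hvar : (((∑ i, ‖w i‖₊ ^ 2) * v : NNReal) : ℝ) = (∑ i, w i ^ 2) * v := by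
    push_cast
    simp only [norm_eq_abs, sq_abs]
  rw [hvar]
  push_cast
  simp_rw [Finset.sum_mul, Finset.sum_div]
  simp only [mul_zero, zero_mul, zero_sub, ← Finset.sum_neg_distrib]
  exact Finset.sum_congr rfl fun i _ ↦ by ring

/-- Privacy-loss bound: off the event where the log-likelihood ratio of two Gaussian products
exceeds `ε`, probabilities are within a factor `exp ε`. -/
lemma pi_gaussianReal_le_exp_mul_add {ι : Type*} [Fintype ι] (a b : ι → ℝ) {v : NNReal}
    (hv : v ≠ 0) (ε : ℝ) {S : Set (ι → ℝ)} (hS : MeasurableSet S) :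
    Measure.pi (fun i ↦ gaussianReal (a i) v) S ≤
      ENNReal.ofReal (exp ε) * Measure.pi (fun i ↦ gaussianReal (b i) v) S +
        Measure.pi (fun i ↦ gaussianReal (a i) v)
          {x | ε < ∑ i, ((x i - b i) ^ 2 - (x i - a i) ^ 2) / (2 * v)} := by
  set B : Set (ι → ℝ) := {x | ε < ∑ i, ((x i - b i) ^ 2 - (x i - a i) ^ 2) / (2 * v)}
  have hBm : MeasurableSet B := measurableSet_lt measurable_const (by fun_prop)
  refine (measure_le_inter_add_sdiff _ S B).trans ?_
  rw [add_comm]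
  refine add_le_add ?_ (measure_mono Set.inter_subset_right)
  refine le_trans ?_ (mul_le_mul_right (measure_mono (Set.sdiff_subset (t := B))) _)
  rw [pi_gaussianReal_eq_withDensity a hv, pi_gaussianReal_eq_withDensity b hv,
    withDensity_apply _ (hS.diff hBm), withDensity_apply _ (hS.diff hBm),
    ← lintegral_const_mul' _ _ ENNReal.ofReal_ne_top]
  refine setLIntegral_mono' (hS.diff hBm) fun x hx ↦ ?_
  rw [← ENNReal.ofReal_mul (exp_pos _).le]
  refine ENNReal.ofReal_le_ofReal ?_
  have hx' : ∑ i, ((x i - b i) ^ 2 - (x i - a i) ^ 2) / (2 * v) ≤ ε := not_lt.1 hx.2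
  have hratio : ∏ i, gaussianPDFReal (a i) v (x i) =
      exp (∑ i, ((x i - b i) ^ 2 - (x i - a i) ^ 2) / (2 * v)) *
        ∏ i, gaussianPDFReal (b i) v (x i) := by
    rw [exp_sum, ← Finset.prod_mul_distrib]
    refine Finset.prod_congr rfl fun i _ ↦ ?_
    rw [gaussianPDFReal, gaussianPDFReal, mul_left_comm, ← exp_add]
    congr 2
    ring
  rw [hratio]
  exact mul_le_mul_of_nonneg_right (exp_le_exp.2 hx')
    (Finset.prod_nonneg fun i _ ↦ gaussianPDFReal_nonneg _ _ _)

lemma gaussianReal_Ioi_zero_le : gaussianReal 0 1 (Set.Ioi 0) ≤ ENNReal.ofReal (1 / 2) := by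
  have hneg : gaussianReal 0 1 (Set.Iio 0) = gaussianReal 0 1 (Set.Ioi 0) := by
    have h := gaussianReal_map_neg (μ := 0) (v := 1)
    rw [neg_zero] at h
    conv_rhs => rw [← h]
    rw [Measure.map_apply (by fun_prop) measurableSet_Ioi]
    congr 1
    ext x
    simp
  have hadd : gaussianReal 0 1 (Set.Iio 0) + gaussianReal 0 1 (Set.Ioi 0) ≤ 1 := by
    rw [← measure_union (s₁ := Set.Iio (0 : ℝ)) (s₂ := Set.Ioi 0)
      (Set.disjoint_left.2 fun x hx hx' ↦ lt_asymm (Set.mem_Iio.1 hx) hx') measurableSet_Ioi]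
    exact prob_le_one
  rw [hneg, ← ENNReal.ofReal_toReal (measure_ne_top (gaussianReal 0 1) (Set.Ioi 0)),
    ← ENNReal.ofReal_add ENNReal.toReal_nonneg ENNReal.toReal_nonneg,
    ENNReal.ofReal_le_one] at hadd
  rw [← ENNReal.ofReal_toReal (measure_ne_top (gaussianReal 0 1) (Set.Ioi 0))]
  exact ENNReal.ofReal_le_ofReal (by linarith)

lemma gaussianReal_Ioi_le_half_mul_exp {t : ℝ} (ht : 0 ≤ t) :
    gaussianReal 0 1 (Set.Ioi t) ≤ ENNReal.ofReal (1 / 2 * exp (-t ^ 2 / 2)) := by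
  have hshift : gaussianReal 0 1 (Set.Ioi t) = gaussianReal (-t) 1 (Set.Ioi 0) := by
    have h := gaussianReal_map_add_const (μ := 0) (v := 1) (-t)
    rw [zero_add] at h
    rw [← h, Measure.map_apply (by fun_prop) measurableSet_Ioi]
    congr 1
    ext x
    simp
  rw [hshift, mul_comm, ENNReal.ofReal_mul (exp_pos _).le]
  refine le_trans ?_ (mul_le_mul_right gaussianReal_Ioi_zero_le _)
  rw [gaussianReal_apply _ one_ne_zero, gaussianReal_apply _ one_ne_zero,
    ← lintegral_const_mul' _ _ ENNReal.ofReal_ne_top]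
  refine setLIntegral_mono' measurableSet_Ioi fun x hx ↦ ?_
  rw [gaussianPDF, gaussianPDF, ← ENNReal.ofReal_mul (exp_pos _).le]
  refine ENNReal.ofReal_le_ofReal ?_
  rw [gaussianPDFReal, gaussianPDFReal, mul_left_comm, ← exp_add]
  refine mul_le_mul_of_nonneg_left (exp_le_exp.2 ?_) (by positivity)
  have : 0 ≤ t * x := mul_nonneg ht (le_of_lt hx)
  simp only [NNReal.coe_one]
  nlinarith

lemma gaussianReal_Ioi_le_of_nonpos {t : ℝ} (ht : t ≤ 0) :
    gaussianReal 0 1 (Set.Ioi t) ≤ ENNReal.ofReal (1 / 2 - t / 2) := by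
  have hpdf : ∀ x, gaussianPDFReal 0 1 x ≤ 1 / 2 := fun x ↦ by
    rw [gaussianPDFReal, NNReal.coe_one, mul_one, mul_one]
    have h2 : (2 : ℝ) ≤ √(2 * π) := Real.le_sqrt_of_sq_le (by nlinarith [pi_gt_three])
    have h3 : (√(2 * π))⁻¹ ≤ 1 / 2 := by
      rw [one_div]
      exact inv_anti₀ (by norm_num) h2
    have h4 : exp (-(x - 0) ^ 2 / 2) ≤ 1 := exp_le_one_iff.2 (by nlinarith [sq_nonneg (x - 0)])
    exact (mul_le_of_le_one_right (by positivity) h4).trans h3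
  have hIoc : gaussianReal 0 1 (Set.Ioc t 0) ≤ ENNReal.ofReal (-t / 2) := by
    rw [gaussianReal_apply _ one_ne_zero]
    calc ∫⁻ x in Set.Ioc t 0, gaussianPDF 0 1 x
        ≤ ∫⁻ _ in Set.Ioc t 0, ENNReal.ofReal (1 / 2) :=
          lintegral_mono fun x ↦ ENNReal.ofReal_le_ofReal (hpdf x)
      _ = ENNReal.ofReal (-t / 2) := by
          rw [setLIntegral_const, Real.volume_Ioc, ← ENNReal.ofReal_mul (by norm_num)]
          congr 1
          ring
  rw [← Set.Ioc_union_Ioi_eq_Ioi ht]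
  refine (measure_union_le _ _).trans ((add_le_add hIoc gaussianReal_Ioi_zero_le).trans_eq ?_)
  rw [← ENNReal.ofReal_add (by linarith) (by norm_num)]
  congr 1
  ring

lemma gaussianReal_Ioi_le_delta {ε δ : ℝ} (hε : ε ∈ Set.Ioo (0 : ℝ) 1)
    (hδ : δ ∈ Set.Ioo (0 : ℝ) 1) {c : ℝ} (hc : c = √(2 * log (1.25 / δ))) :
    gaussianReal 0 1 (Set.Ioi (c - ε / (2 * c))) ≤ ENNReal.ofReal δ := by
  obtain ⟨hε0, hε1⟩ := hε
  obtain ⟨hδ0, hδ1⟩ := hδ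
  have hlog : 1 / 5 ≤ log (1.25 / δ) := by
    have h1 : (1.25 : ℝ) ≤ 1.25 / δ := by
      rw [le_div_iff₀ hδ0]
      linarith
    have h2 := one_sub_inv_le_log_of_pos (show (0 : ℝ) < 1.25 by norm_num)
    have h3 := log_le_log (by norm_num) h1
    norm_num at h2 h3 ⊢
    linarith
  have hc2 : c ^ 2 = 2 * log (1.25 / δ) := by rw [hc, sq_sqrt (by linarith)]
  have hc6 : 3 / 5 ≤ c := hc ▸ Real.le_sqrt_of_sq_le (by linarith)
  have hδ_eq : δ = 1.25 * exp (-c ^ 2 / 2) := by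
    rw [hc2, show -(2 * log (1.25 / δ)) / 2 = -log (1.25 / δ) by ring, exp_neg,
      exp_log (by positivity)]
    field_simp
  have hc0 : 0 < c := by linarith
  have hu : ε / (2 * c) * c = ε / 2 := by field_simp
  have hu1 : 0 ≤ ε / (2 * c) := by positivity
  set u := ε / (2 * c)
  rcases le_total 0 (c - u) with ht | ht
  · refine (gaussianReal_Ioi_le_half_mul_exp ht).trans (ENNReal.ofReal_le_ofReal ?_)
    have h1 : exp (-(c - u) ^ 2 / 2) ≤ exp (1 / 2) * exp (-c ^ 2 / 2) := by
      rw [← exp_add]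
      exact exp_le_exp.2 (by nlinarith [sq_nonneg u])
    have h2 : exp (1 / 2) ≤ 5 / 2 := by
      have h3 : exp (1 / 2) ^ 2 = exp 1 := by rw [← exp_nat_mul]; norm_num
      nlinarith [exp_one_lt_d9, exp_pos (1 / 2 : ℝ)]
    have h3 := mul_le_mul_of_nonneg_right h2 (exp_pos (-c ^ 2 / 2)).le
    linarith
  · refine (gaussianReal_Ioi_le_of_nonpos ht).trans (ENNReal.ofReal_le_ofReal ?_)
    have h1 := add_one_le_exp (-c ^ 2 / 2)
    have h2 : c ^ 2 ≤ ε / 2 := by nlinarith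
    have h3 : u ≤ 5 / 6 := by nlinarith
    nlinarith

/-- the Gaussian mechanism with L2-sensitivity `Δ` and i.i.d. `N(0,σ²)` noise
coordinates is `(ε,δ)`-DP whenever `σ ≥ Δ √(2 log(1.25/δ)) / ε`, for `ε, δ ∈ (0,1)`. -/
theorem gaussian_mechanism_dp
    {D : Type*} (adj : D → D → Prop) (n : ℕ) (g : D → (Fin n → ℝ))
    (Δ σ ε δ : ℝ) (hΔ : 0 < Δ) (hσ : 0 < σ)
    (hε : ε ∈ Set.Ioo (0:ℝ) 1) (hδ : δ ∈ Set.Ioo (0:ℝ) 1)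
    (hsens : ∀ d d', adj d d' →
      Real.sqrt (∑ i, (g d i - g d' i) ^ 2) ≤ Δ)
    (hσbig : σ ≥ Δ * Real.sqrt (2 * Real.log (1.25 / δ)) / ε)
    (M : D → Measure (Fin n → ℝ))
    (hM : ∀ d, M d = Measure.map (fun z => g d + z)
      (Measure.pi fun _ => gaussianReal 0 ⟨σ ^ 2, by positivity⟩)) :
    ∀ d d', adj d d' → ∀ S : Set (Fin n → ℝ), MeasurableSet S →
      M d S ≤ ENNReal.ofReal (exp ε) * M d' S + ENNReal.ofReal δ := by
  intro d d' hadj S hS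
  set v : NNReal := ⟨σ ^ 2, by positivity⟩
  have hv_coe : (v : ℝ) = σ ^ 2 := rfl
  have hv : v ≠ 0 := fun h ↦ (pow_pos hσ 2).ne' (by rw [← hv_coe, h]; rfl)
  have hM_pi : ∀ d, M d = Measure.pi fun i ↦ gaussianReal (g d i) v := fun d ↦ by
    have h := Measure.pi_map_pi (μ := fun _ : Fin n ↦ gaussianReal 0 v)
      (f := fun i z ↦ g d i + z) (fun i ↦ by fun_prop)
    simp only [gaussianReal_map_const_add, zero_add] at h
    rw [hM d, ← h]
    rfl
  rw [hM_pi d, hM_pi d']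
  refine (pi_gaussianReal_le_exp_mul_add _ _ hv ε hS).trans (add_le_add le_rfl ?_)
  rw [← hM_pi, hM d, Measure.map_apply (by fun_prop)
    (measurableSet_lt measurable_const (by fun_prop))]
  set w : Fin n → ℝ := fun i ↦ g d i - g d' i with hw
  set r := √(∑ i, w i ^ 2)
  have hr_sq : r ^ 2 = ∑ i, w i ^ 2 := sq_sqrt (Finset.sum_nonneg fun i _ ↦ sq_nonneg _)
  have hr_nonneg : 0 ≤ r := sqrt_nonneg _
  have hr_le : r ≤ Δ := hsens d d' hadj
  have hloss : ∀ z : Fin n → ℝ,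
      ∑ i, (((g d + z) i - g d' i) ^ 2 - ((g d + z) i - g d i) ^ 2) / (2 * v) =
        (2 * ∑ i, w i * z i + r ^ 2) / (2 * σ ^ 2) := fun z ↦ by
    rw [hr_sq, ← Finset.sum_div, Finset.mul_sum, ← Finset.sum_add_distrib, hv_coe]
    congr 1
    exact Finset.sum_congr rfl fun i _ ↦ by simp only [Pi.add_apply, hw]; ring
  simp only [Set.preimage_ofPred_eq, hloss]
  rcases hr_nonneg.eq_or_lt with hr0 | hr0
  · have hw0 : ∀ i, w i = 0 := fun i ↦ by
      have h0 : ∑ i, w i ^ 2 = 0 := by rw [← hr_sq, ← hr0]; norm_num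
      exact pow_eq_zero_iff two_ne_zero |>.1
        ((Finset.sum_eq_zero_iff_of_nonneg fun i _ ↦ sq_nonneg _).1 h0 i (Finset.mem_univ i))
    simp [hw0, ← hr0, hε.1.not_gt]
  · have hlaw := map_sum_mul_pi_gaussianReal (fun i ↦ w i / (σ * r)) v
    have hvar : (∑ i, ‖w i / (σ * r)‖₊ ^ 2) * v = 1 := by
      refine NNReal.coe_injective ?_
      push_cast
      simp only [norm_eq_abs, sq_abs, div_pow, hv_coe]
      rw [← Finset.sum_div, ← hr_sq]
      field_simp
    rw [hvar] at hlaw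
    obtain ⟨c, hc⟩ : ∃ c, c = √(2 * log (1.25 / δ)) := ⟨_, rfl⟩
    refine le_trans ?_ (gaussianReal_Ioi_le_delta hε hδ hc)
    rw [← hlaw, Measure.map_apply (by fun_prop) measurableSet_Ioi]
    refine measure_mono fun z hz ↦ ?_
    have hc0 : 0 < c := by
      rw [hc]
      refine sqrt_pos.2 (mul_pos two_pos (log_pos ?_))
      rw [lt_div_iff₀ hδ.1]
      linarith [hδ.2]
    have hrσ : r * c ≤ σ * ε := by
      rw [← hc, ge_iff_le, div_le_iff₀ hε.1] at hσbig
      exact (mul_le_mul_of_nonneg_right hr_le hc0.le).trans hσbig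
    have hz' : ε < (2 * ∑ i, w i * z i + r ^ 2) / (2 * σ ^ 2) := hz
    rw [lt_div_iff₀ (by positivity)] at hz'
    have h1 : c ≤ σ * ε / r := by rwa [le_div_iff₀ hr0, mul_comm]
    have h2 : r / (2 * σ) ≤ ε / (2 * c) := by
      rw [div_le_div_iff₀ (by positivity) (by positivity)]
      linarith
    have h3 : ∑ i, w i / (σ * r) * z i = (∑ i, w i * z i) / (σ * r) := by
      rw [Finset.sum_div]
      exact Finset.sum_congr rfl fun i _ ↦ by ring
    have h4 : σ * ε / r - r / (2 * σ) < (∑ i, w i * z i) / (σ * r) := by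
      rw [lt_div_iff₀ (by positivity)]
      have : (σ * ε / r - r / (2 * σ)) * (σ * r) = σ ^ 2 * ε - r ^ 2 / 2 := by field_simp
      rw [this]
      linarith
    change c - ε / (2 * c) < ∑ i, w i / (σ * r) * z i
    rw [h3]
    linarith
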